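/- arXiv:1008.3295 — 5 statements merged into one kernel-verified Lean document; each statement's English description precedes it below -/
import Mathlib

section
/- Let α be a type, let n ≥ 1, let d : Fin n → α be injective, and let r ∈ α with r not in the range of d. For k ∈ {0, 1, …, n−1}, let L_k be the list (d₀, …, d_{k−1}, r, d_k, …, d_{n−1}) obtained by inserting r at index k into the list (d₀, …, d_{n−1}). Then the collection of finite sets { elements of the first j entries of L_k : 0 ≤ k ≤ n−1, 1 ≤ j ≤ n+1 } has cardinality at most 3n − 1. -/
theorem List.take_insertIdx_of_le {α : Type*} (a : α) (l : List α) {k j : ℕ} (h : j ≤ k) :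
    (l.insertIdx k a).take j = l.take j := by
  induction l generalizing k j with
  | nil => cases k <;> cases j <;> simp_all
  | cons b l ih =>
    cases k with
    | zero => simp_all
    | succ k =>
      cases j with
      | zero => simp
      | succ j => simpa using ih (Nat.le_of_succ_le_succ h)

theorem List.toFinset_take_succ_insertIdx {α : Type*} [DecidableEq α] (a : α) (l : List α)
    {k j : ℕ} (hk : k ≤ l.length) (h : k ≤ j) :
    ((l.insertIdx k a).take (j + 1)).toFinset = insert a (l.take j).toFinset := by
  induction l generalizing k j with
  | nil => simp_all
  | cons b l ih =>
    cases k with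
    | zero => simp
    | succ k =>
      cases j with
      | zero => omega
      | succ j =>
        have := ih (Nat.le_of_succ_le_succ hk) (Nat.le_of_succ_le_succ h)
        simp [this, Finset.insert_comm]

/-- Lemma 2 of the paper: Let `d : Fin n → α` be `n ≥ 1` distinct
destinations and `r` a further element not among them. For `0 ≤ k ≤ n-1` let `L k` be
the list obtained by inserting `r` at index `k` into the list `(d 0, …, d (n-1))`.
Then the collection of sets of elements of nonempty prefixes (of the first `j` entries,
`1 ≤ j ≤ n+1`) of the lists `L k` has cardinality at most `3n - 1`. -/
theorem card_source_hyperarcs_le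
    {α : Type*} [DecidableEq α] (n : ℕ) (hn : 1 ≤ n)
    (d : Fin n → α) (hd : Function.Injective d) (r : α) (hr : r ∉ Set.range d) :
    {S : Finset α | ∃ k j : ℕ, k ≤ n - 1 ∧ 1 ≤ j ∧ j ≤ n + 1 ∧
        S = (((List.ofFn d).insertIdx k r).take j).toFinset}.ncard ≤ 3 * n - 1 := by
  set f : ℕ → Finset α := fun j => ((List.ofFn d).take j).toFinset with hf
  set T : Finset (Finset α) := (Finset.Icc 1 (n - 1)).image f ∪
    (Finset.range (n + 1)).image (fun j => insert r (f j)) with hT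
  have hsub : {S : Finset α | ∃ k j : ℕ, k ≤ n - 1 ∧ 1 ≤ j ∧ j ≤ n + 1 ∧
      S = (((List.ofFn d).insertIdx k r).take j).toFinset} ⊆ (T : Set (Finset α)) := by
    rintro S ⟨k, j, hk, hj, hjn, rfl⟩
    rw [Finset.mem_coe, hT, Finset.mem_union, Finset.mem_image, Finset.mem_image]
    rcases le_or_gt j k with h | h
    · exact Or.inl ⟨j, Finset.mem_Icc.2 ⟨hj, h.trans hk⟩, by rw [List.take_insertIdx_of_le r _ h]⟩
    · obtain ⟨i, rfl⟩ := Nat.exists_eq_add_of_le' hj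
      refine Or.inr ⟨i, Finset.mem_range.2 (by omega), ?_⟩
      rw [List.toFinset_take_succ_insertIdx r _ (by rw [List.length_ofFn]; omega) (by omega)]
  have h₁ : ((Finset.Icc 1 (n - 1)).image f).card ≤ n - 1 := by
    simpa using Finset.card_image_le (s := Finset.Icc 1 (n - 1)) (f := f)
  have h₂ : ((Finset.range (n + 1)).image (fun j => insert r (f j))).card ≤ n + 1 := by
    simpa using Finset.card_image_le (s := Finset.range (n + 1)) (f := fun j => insert r (f j))
  have h₃ : T.card ≤ _ := Finset.card_union_le _ _
  have h₄ := Set.ncard_le_ncard hsub T.finite_toSet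
  rw [Set.ncard_coe_finset] at h₄
  omega
end

section
/- Let n ∈ ℕ, let a : Fin n → ℝ be injective, and for each i let p(i) = (a(i), 0) ∈ ℝ² be collinear destination points. Then the number of permutations σ of Fin n for which there exists a viewpoint r ∈ ℝ² with dist(r, p(σ(i))) < dist(r, p(σ(j))) for all i < j is at most n(n−1)/2 + 1. -/
/-- The pairs `(i, j)` with `a i < a j` that the ordering `σ` lists in the opposite order. -/
noncomputable def inversionPairs {n : ℕ} (a : Fin n → ℝ) (σ : Equiv.Perm (Fin n)) :
    Finset (Fin n × Fin n) :=
  {q | a q.1 < a q.2 ∧ σ.symm q.2 < σ.symm q.1}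

theorem mem_inversionPairs {n : ℕ} {a : Fin n → ℝ} {σ : Equiv.Perm (Fin n)}
    {q : Fin n × Fin n} :
    q ∈ inversionPairs a σ ↔ a q.1 < a q.2 ∧ σ.symm q.2 < σ.symm q.1 := by
  simp [inversionPairs]

theorem card_inversionPairs_le {n : ℕ} (a : Fin n → ℝ) (σ : Equiv.Perm (Fin n)) :
    (inversionPairs a σ).card ≤ n * (n - 1) / 2 := by
  have hdisj : Disjoint (inversionPairs a σ)
      ((inversionPairs a σ).map (Equiv.prodComm _ _).toEmbedding) := by
    rw [Finset.disjoint_left]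
    rintro ⟨i, j⟩ h h'
    simp only [Finset.mem_map_equiv, mem_inversionPairs] at h h'
    exact lt_asymm h.1 h'.1
  have hsub : (inversionPairs a σ).disjUnion _ hdisj ⊆ Finset.univ.offDiag := by
    rintro ⟨i, j⟩ h
    simp only [Finset.mem_disjUnion, Finset.mem_map_equiv, mem_inversionPairs] at h
    simp only [Finset.mem_offDiag, Finset.mem_univ, true_and]
    rintro rfl
    rcases h with h | h <;> exact lt_irrefl _ h.1
  have hcard := Finset.card_le_card hsub
  rw [Finset.card_disjUnion, Finset.card_map, Finset.offDiag_card, Finset.card_univ,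
    Fintype.card_fin] at hcard
  rw [Nat.le_div_iff_mul_le two_pos, Nat.mul_sub_one]
  omega

theorem Equiv.Perm.eq_of_symm_lt_iff {n : ℕ} {σ τ : Equiv.Perm (Fin n)}
    (h : ∀ i j, σ.symm i < σ.symm j ↔ τ.symm i < τ.symm j) : σ = τ := by
  let e : Fin n ≃o Fin n :=
    { σ.trans τ.symm with
      map_rel_iff' := by
        intro i j
        simpa using not_congr (h (σ j) (σ i)).symm }
  have he : e = OrderIso.refl _ := Subsingleton.elim _ _
  ext1 i
  have hi : τ.symm (σ i) = i := congrArg (fun f : Fin n ≃o Fin n => f i) he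
  exact (Equiv.symm_apply_eq τ).1 hi

theorem inversionPairs_injective {n : ℕ} {a : Fin n → ℝ} (ha : Function.Injective a) :
    Function.Injective (inversionPairs a) := by
  intro σ τ h
  have key : ∀ i j, a i < a j → (σ.symm j < σ.symm i ↔ τ.symm j < τ.symm i) := by
    intro i j hij
    have := Finset.ext_iff.1 h (i, j)
    simpa only [mem_inversionPairs, hij, true_and] using this
  refine Equiv.Perm.eq_of_symm_lt_iff fun i j => ?_
  rcases lt_trichotomy (a i) (a j) with hij | hij | hij
  · have hne : i ≠ j := fun e => hij.ne (congrArg a e)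
    have hk := not_congr (key i j hij)
    rwa [not_lt, not_lt, (σ.symm.injective.ne hne).le_iff_lt,
      (τ.symm.injective.ne hne).le_iff_lt] at hk
  · simp [ha hij]
  · exact key j i hij

theorem symm_lt_symm_iff_of_sorts {n : ℕ} {σ : Equiv.Perm (Fin n)} {d : Fin n → ℝ}
    (h : ∀ i j, i < j → d (σ i) < d (σ j)) (i j : Fin n) :
    σ.symm i < σ.symm j ↔ d i < d j := by
  have hmono : StrictMono (d ∘ σ) := fun i j => h i j
  simpa using (hmono.lt_iff_lt (a := σ.symm i) (b := σ.symm j)).symm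

theorem inversionPairs_subset_of_le {n : ℕ} {a : Fin n → ℝ} {σ τ : Equiv.Perm (Fin n)} {x y : ℝ}
    (hσ : ∀ i j, i < j → (x - a (σ i)) ^ 2 < (x - a (σ j)) ^ 2)
    (hτ : ∀ i j, i < j → (y - a (τ i)) ^ 2 < (y - a (τ j)) ^ 2) (hxy : x ≤ y) :
    inversionPairs a σ ⊆ inversionPairs a τ := by
  rintro ⟨i, j⟩ h
  simp only [mem_inversionPairs] at h ⊢
  obtain ⟨hij, hs⟩ := h
  refine ⟨hij, ?_⟩
  rw [symm_lt_symm_iff_of_sorts (d := fun k => (x - a k) ^ 2) hσ] at hs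
  rw [symm_lt_symm_iff_of_sorts (d := fun k => (y - a k) ^ 2) hτ]
  nlinarith [mul_nonneg (sub_nonneg.2 hxy) (sub_nonneg.2 hij.le)]

theorem dist_lt_dist_horizontal_iff (r : EuclideanSpace ℝ (Fin 2)) (s t : ℝ) :
    dist r ((EuclideanSpace.equiv (Fin 2) ℝ).symm ![s, 0]) <
        dist r ((EuclideanSpace.equiv (Fin 2) ℝ).symm ![t, 0]) ↔
      (r 0 - s) ^ 2 < (r 0 - t) ^ 2 := by
  rw [EuclideanSpace.dist_eq, EuclideanSpace.dist_eq, Real.sqrt_lt_sqrt_iff (by positivity)]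
  simp [Fin.sum_univ_two, Real.dist_eq, sq_abs]

/-- For `n` collinear destinations `p i = (a i, 0)` in the Euclidean plane
(with `a` injective), the number of permutations `σ` of `Fin n` realizable as the strict
ordering of the destinations by increasing distance from some viewpoint `r` is at most
`n(n-1)/2 + 1`. -/
theorem card_realizable_orderings_collinear_le
    (n : ℕ) (a : Fin n → ℝ) (ha : Function.Injective a)
    (p : Fin n → EuclideanSpace ℝ (Fin 2))
    (hp : ∀ i, p i = (EuclideanSpace.equiv (Fin 2) ℝ).symm ![a i, 0]) :
    {σ : Equiv.Perm (Fin n) | ∃ r : EuclideanSpace ℝ (Fin 2),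
        ∀ i j : Fin n, i < j → dist r (p (σ i)) < dist r (p (σ j))}.ncard
      ≤ n * (n - 1) / 2 + 1 := by
  simp only [hp, dist_lt_dist_horizontal_iff]
  have hmaps : ∀ σ ∈ {σ : Equiv.Perm (Fin n) | ∃ r : EuclideanSpace ℝ (Fin 2),
      ∀ i j : Fin n, i < j → (r 0 - a (σ i)) ^ 2 < (r 0 - a (σ j)) ^ 2},
      (inversionPairs a σ).card ∈ (Finset.range (n * (n - 1) / 2 + 1) : Set ℕ) := fun σ _ => by
    simpa [Nat.lt_succ_iff] using card_inversionPairs_le a σ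
  refine (Set.ncard_le_ncard_of_injOn _ hmaps ?_).trans_eq (by simp)
  rintro σ ⟨r, hr⟩ τ ⟨s, hs⟩ hcard
  apply inversionPairs_injective ha
  rcases le_total (r 0) (s 0) with h | h
  · exact Finset.eq_of_subset_of_card_le (inversionPairs_subset_of_le hr hs h) hcard.ge
  · exact (Finset.eq_of_subset_of_card_le (inversionPairs_subset_of_le hs hr h) hcard.le).symm
end

section
/- Let n ≥ 1, let a : Fin n → ℝ be injective, and for each i let p(i) = (a(i), 0) ∈ ℝ² be collinear destination points. Then the collection of nonempty sets of the form {i ∈ Fin n : dist(r, p(i)) ≤ ρ}, taken over all r ∈ ℝ² and all ρ ≥ 0, has cardinality at most n². -/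
/-- A set of points on the first coordinate axis cut out by a closed disc is order-convex. -/
theorem dist_axis_le_of_mem_Icc {r : EuclideanSpace ℝ (Fin 2)} {ρ x y z : ℝ}
    (hx : dist r ((EuclideanSpace.equiv (Fin 2) ℝ).symm ![x, 0]) ≤ ρ)
    (hz : dist r ((EuclideanSpace.equiv (Fin 2) ℝ).symm ![z, 0]) ≤ ρ)
    (hy : y ∈ Set.Icc x z) :
    dist r ((EuclideanSpace.equiv (Fin 2) ℝ).symm ![y, 0]) ≤ ρ := by
  obtain ⟨hxy, hyz⟩ := hy
  have hρ : 0 ≤ ρ := dist_nonneg.trans hx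
  simp only [EuclideanSpace.dist_eq, Real.sqrt_le_left hρ, Fin.sum_univ_two, Real.dist_eq,
    sq_abs, PiLp.continuousLinearEquiv_symm_apply, Matrix.cons_val_zero,
    Matrix.cons_val_one] at hx hz ⊢
  rcases le_total (r 0) y with h | h
  · nlinarith
  · nlinarith

/-- Lemma 3 of the paper: For `n ≥ 1` collinear destinations
`p i = (a i, 0)` in the Euclidean plane (with `a` injective), the collection of
nonempty receiver sets `{i : dist r (p i) ≤ ρ}`, over all viewpoints `r` and all
thresholds `ρ ≥ 0`, has cardinality at most `n²`. -/
theorem card_relay_hyperarcs_collinear_le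
    (n : ℕ) (hn : 1 ≤ n) (a : Fin n → ℝ) (ha : Function.Injective a)
    (p : Fin n → EuclideanSpace ℝ (Fin 2))
    (hp : ∀ i, p i = (EuclideanSpace.equiv (Fin 2) ℝ).symm ![a i, 0]) :
    {S : Finset (Fin n) | S.Nonempty ∧ ∃ (r : EuclideanSpace ℝ (Fin 2)) (ρ : ℝ),
        0 ≤ ρ ∧ ∀ i, i ∈ S ↔ dist r (p i) ≤ ρ}.ncard ≤ n ^ 2 := by
  classical
  let interval : Fin n × Fin n → Finset (Fin n) :=
    fun q => Finset.univ.filter fun k => a k ∈ Set.Icc (a q.1) (a q.2)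
  have hsub : {S : Finset (Fin n) | S.Nonempty ∧
      ∃ (r : EuclideanSpace ℝ (Fin 2)) (ρ : ℝ), 0 ≤ ρ ∧ ∀ i, i ∈ S ↔ dist r (p i) ≤ ρ} ⊆
      ((Finset.univ.image interval : Finset (Finset (Fin n))) : Set (Finset (Fin n))) := by
    rintro S ⟨hS, r, ρ, -, hmem⟩
    obtain ⟨i, hi, hmin⟩ := S.exists_min_image a hS
    obtain ⟨j, hj, hmax⟩ := S.exists_max_image a hS
    refine Finset.mem_coe.2 (Finset.mem_image.2 ⟨(i, j), Finset.mem_univ _, ?_⟩)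
    ext k
    simp only [interval, Finset.mem_filter, Finset.mem_univ, true_and]
    refine ⟨fun hk => ?_, fun hk => ⟨hmin k hk, hmax k hk⟩⟩
    rw [hmem, hp] at hi hj ⊢
    exact dist_axis_le_of_mem_Icc hi hj hk
  calc _ ≤ _ := Set.ncard_le_ncard hsub (Finset.finite_toSet _)
    _ = (Finset.univ.image interval).card := Set.ncard_coe_finset _
    _ ≤ (Finset.univ : Finset (Fin n × Fin n)).card := Finset.card_image_le
    _ = n ^ 2 := by simp [sq]
end

section
/- Let α be a type, n ≥ 1, β ≥ 1, and let L : Fin β → List α be a sequence of lists, each of which has no duplicates and has the same underlying finite set of n elements, such that for each t, the list L(t+1) is obtained from L(t) by swapping two adjacent entries (i.e., L(t+1) = L(t).insertIdx applied so that the entries at some indices p and p+1 are exchanged and all other entries are unchanged). Then the collection of finite sets { elements of the first j entries of L(t) : t ∈ Fin β, 1 ≤ j ≤ n } has cardinality at most n + 2(β − 1). -/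
/-- Exchanging the entries at positions `q` and `q + 1` of a list does not change the set of the
first `j` entries, unless `j = q + 1`. -/
theorem toFinset_take_eq_of_adjacent_swap {α : Type*} [DecidableEq α] {l l' : List α} {q j : ℕ}
    (h₁ : l'[q]? = l[q + 1]?) (h₂ : l'[q + 1]? = l[q]?)
    (h : ∀ i, i ≠ q → i ≠ q + 1 → l'[i]? = l[i]?) (hj : j ≠ q + 1) :
    (l'.take j).toFinset = (l.take j).toFinset := by
  have mem_take (m : List α) (x : α) : x ∈ m.take j ↔ ∃ i < j, m[i]? = some x := by
    simp only [List.mem_iff_getElem?, List.getElem?_take]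
    grind
  ext x
  simp only [List.mem_toFinset, mem_take]
  constructor
  all_goals
    rintro ⟨i, hi, hx⟩
    rcases eq_or_ne i q with rfl | hq
    · exact ⟨i + 1, by omega, by simp_all⟩
    rcases eq_or_ne i (q + 1) with rfl | hq'
    · exact ⟨q, by omega, by simp_all⟩
    · exact ⟨i, hi, by simp_all⟩

/-- Let `L : Fin β → List α` (`n ≥ 1`, `β ≥ 1`) be lists without
duplicates, all of length `n` and with the same underlying finite set of elements,
such that each `L (t+1)` is obtained from `L t` by swapping two adjacent entries.
Then the collection of sets of elements of nonempty prefixes (first `j` entries,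
`1 ≤ j ≤ n`) of the lists `L t` has cardinality at most `n + 2(β - 1)`. -/
theorem card_prefix_sets_of_adjacent_swaps_le
    {α : Type*} [DecidableEq α] (n β : ℕ) (hn : 1 ≤ n) (hβ : 1 ≤ β)
    (L : Fin β → List α)
    (hnodup : ∀ t, (L t).Nodup)
    (hlen : ∀ t, (L t).length = n)
    (hset : ∀ t, (L t).toFinset = (L ⟨0, by omega⟩).toFinset)
    (hswap : ∀ (t : ℕ) (ht : t + 1 < β), ∃ q, q + 1 < n ∧
        (L ⟨t + 1, ht⟩)[q]? = (L ⟨t, by omega⟩)[q + 1]? ∧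
        (L ⟨t + 1, ht⟩)[q + 1]? = (L ⟨t, by omega⟩)[q]? ∧
        ∀ i, i ≠ q → i ≠ q + 1 → (L ⟨t + 1, ht⟩)[i]? = (L ⟨t, by omega⟩)[i]?) :
    {S : Finset α | ∃ (t : Fin β) (j : ℕ), 1 ≤ j ∧ j ≤ n ∧
        S = ((L t).take j).toFinset}.ncard ≤ n + 2 * (β - 1) := by
  have key : ∀ k (hk : k < β), ∃ F : Finset (Finset α), F.card ≤ n + k ∧
      ∀ t (ht : t ≤ k) j, 1 ≤ j → j ≤ n → ((L ⟨t, by omega⟩).take j).toFinset ∈ F := by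
    intro k
    induction k with
    | zero =>
      refine fun hk => ⟨(Finset.Icc 1 n).image fun j => ((L ⟨0, hk⟩).take j).toFinset,
        Finset.card_image_le.trans (by simp), fun t ht j h1 hn => ?_⟩
      obtain rfl : t = 0 := by omega
      exact Finset.mem_image_of_mem _ (Finset.mem_Icc.2 ⟨h1, hn⟩)
    | succ k ih =>
      intro hk
      obtain ⟨F, hF, hmem⟩ := ih (by omega)
      obtain ⟨q, -, h₁, h₂, h⟩ := hswap k hk
      refine ⟨insert ((L ⟨k + 1, hk⟩).take (q + 1)).toFinset F,
        (Finset.card_insert_le _ _).trans (by omega), fun t ht j h1 hn => ?_⟩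
      rcases ht.lt_or_eq with ht | rfl
      · exact Finset.mem_insert_of_mem (hmem t (by omega) j h1 hn)
      rcases eq_or_ne j (q + 1) with rfl | hj
      · exact Finset.mem_insert_self _ _
      · rw [toFinset_take_eq_of_adjacent_swap h₁ h₂ h hj]
        exact Finset.mem_insert_of_mem (hmem k le_rfl j h1 hn)
  obtain ⟨F, hF, hmem⟩ := key (β - 1) (by omega)
  calc
    _ ≤ (F : Set (Finset α)).ncard := by
      refine Set.ncard_le_ncard ?_ F.finite_toSet
      rintro S ⟨t, j, h1, hn, rfl⟩
      exact hmem t (by omega) j h1 hn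
    _ ≤ n + 2 * (β - 1) := by
      rw [Set.ncard_coe_finset]
      omega
end

section
/- Let n ∈ ℕ and let p : Fin n → ℝ² be injective (arbitrarily placed destination points). Let m = n(n−1)/2. Then the number of permutations σ of Fin n for which there exists a viewpoint r ∈ ℝ² with dist(r, p(σ(i))) < dist(r, p(σ(j))) for all i < j is at most 1 + m + m(m−1)/2. -/
open Finset

/-- Affine functionals, given by gradients `v i` and constants `c i`, that take every pattern of
nonzero signs have linearly independent gradients. -/
theorem linearIndependent_of_forall_sign_pattern {V ι : Type*} [NormedAddCommGroup V]
    [InnerProductSpace ℝ V] [Fintype ι] (v : ι → V) (c : ι → ℝ)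
    (h : ∀ t : Set ι, ∃ r : V, ∀ i,
      (i ∈ t → inner ℝ r (v i) + c i < 0) ∧ (i ∉ t → 0 < inner ℝ r (v i) + c i)) :
    LinearIndependent ℝ v := by
  by_contra hv
  obtain ⟨g, hg, i₀, hi₀⟩ := Fintype.not_linearIndependent_iff.1 hv
  have key : ∀ r : V, ∑ i, g i * (inner ℝ r (v i) + c i) = ∑ i, g i * c i := by
    intro r
    have hr : ∑ i, g i * inner ℝ r (v i) = 0 := by
      simpa [inner_sum, inner_smul_right] using congrArg (fun w => inner ℝ r w) hg
    simp only [mul_add, sum_add_distrib, hr, zero_add]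
  obtain ⟨r, hr⟩ := h {i | g i < 0}
  obtain ⟨s, hs⟩ := h {i | 0 < g i}
  have hpos : 0 < ∑ i, g i * c i := by
    rw [← key r]
    refine sum_pos' (fun i _ => ?_) ⟨i₀, mem_univ _, ?_⟩
    · rcases lt_or_ge (g i) 0 with hi | hi
      · exact (mul_pos_of_neg_of_neg hi ((hr i).1 hi)).le
      · exact mul_nonneg hi ((hr i).2 (not_lt.2 hi)).le
    · rcases lt_or_gt_of_ne hi₀ with hi | hi
      · exact mul_pos_of_neg_of_neg hi ((hr i₀).1 hi)
      · exact mul_pos hi ((hr i₀).2 (not_lt.2 hi.le))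
  have hneg : ∑ i, g i * c i ≤ 0 := by
    rw [← key s]
    refine sum_nonpos fun i _ => ?_
    rcases lt_or_ge 0 (g i) with hi | hi
    · exact (mul_neg_of_pos_of_neg hi ((hs i).1 hi)).le
    · exact mul_nonpos_of_nonpos_of_nonneg hi ((hs i).2 (not_lt.2 hi)).le
  exact absurd hpos (not_lt.2 hneg)

/-- A family of sign patterns, without zeros, of affine functionals has VC dimension at most the
dimension of the space. -/
theorem vcDim_le_finrank_of_sign_patterns {V ι : Type*} [NormedAddCommGroup V]
    [InnerProductSpace ℝ V] [FiniteDimensional ℝ V] [DecidableEq ι] (v : ι → V) (c : ι → ℝ)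
    (𝒜 : Finset (Finset ι))
    (h : ∀ u ∈ 𝒜, ∃ r : V, ∀ i,
      (i ∈ u → inner ℝ r (v i) + c i < 0) ∧ (i ∉ u → 0 < inner ℝ r (v i) + c i)) :
    𝒜.vcDim ≤ Module.finrank ℝ V := by
  classical
  refine Finset.sup_le fun T hT => ?_
  have hT := mem_shatterer.1 hT
  have hind : LinearIndependent ℝ fun i : T => v i := by
    refine linearIndependent_of_forall_sign_pattern _ (fun i : T => c i) fun t => ?_
    obtain ⟨u, hu, hut⟩ := hT (t := T.filter fun i => ∃ hi : i ∈ T, ⟨i, hi⟩ ∈ t) (filter_subset _ _)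
    obtain ⟨r, hr⟩ := h u hu
    have hmem : ∀ i : T, (i : ι) ∈ u ↔ i ∈ t := fun i => by
      simpa [i.2] using Finset.ext_iff.1 hut i
    exact ⟨r, fun i => ⟨fun hi => (hr i).1 ((hmem i).2 hi),
      fun hi => (hr i).2 (mt (hmem i).1 hi)⟩⟩
  simpa using hind.fintype_card_le_finrank

theorem dist_lt_dist_iff_inner {V : Type*} [NormedAddCommGroup V] [InnerProductSpace ℝ V]
    (r a b : V) :
    dist r a < dist r b ↔ inner ℝ r ((2 : ℝ) • (b - a)) + (‖a‖ ^ 2 - ‖b‖ ^ 2) < 0 := by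
  rw [dist_eq_norm, dist_eq_norm, ← sq_lt_sq₀ (norm_nonneg _) (norm_nonneg _),
    norm_sub_sq_real, norm_sub_sq_real, inner_smul_right, inner_sub_right]
  constructor <;> intro h <;> linarith

theorem dist_lt_dist_iff_inner' {V : Type*} [NormedAddCommGroup V] [InnerProductSpace ℝ V]
    (r a b : V) :
    dist r b < dist r a ↔ 0 < inner ℝ r ((2 : ℝ) • (b - a)) + (‖a‖ ^ 2 - ‖b‖ ^ 2) := by
  rw [dist_lt_dist_iff_inner, inner_smul_right, inner_smul_right, inner_sub_right, inner_sub_right]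
  constructor <;> intro h <;> linarith

/-- The pairs `a < b` that a permutation, read as a list, presents in increasing order. -/
def Equiv.Perm.noninversions {n : ℕ} (σ : Equiv.Perm (Fin n)) :
    Finset {e : Fin n × Fin n // e.1 < e.2} :=
  univ.filter fun e => σ.symm e.1.1 < σ.symm e.1.2

theorem Equiv.Perm.noninversions_injective {n : ℕ} :
    Function.Injective (Equiv.Perm.noninversions (n := n)) := by
  intro σ τ h
  have hlt : ∀ e : {e : Fin n × Fin n // e.1 < e.2},
      σ.symm e.1.1 < σ.symm e.1.2 ↔ τ.symm e.1.1 < τ.symm e.1.2 := fun e => by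
    simpa [Equiv.Perm.noninversions] using Finset.ext_iff.1 h e
  have hmono : StrictMono fun i => τ.symm (σ i) := by
    intro i j hij
    rcases lt_trichotomy (σ i) (σ j) with hs | hs | hs
    · exact (hlt ⟨(σ i, σ j), hs⟩).1 (by simpa using hij)
    · exact absurd (σ.injective hs) hij.ne
    · have := mt (hlt ⟨(σ j, σ i), hs⟩).2 (by simpa using hij.le)
      exact lt_of_le_of_ne (not_lt.1 this) fun he => hij.ne (σ.injective (τ.symm.injective he))
  have hid : (fun i => τ.symm (σ i)) = id :=
    (hmono.range_inj strictMono_id).1 (by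
      rw [Set.range_id]
      exact (σ.trans τ.symm).surjective.range_eq)
  ext1 i
  simpa [Equiv.symm_apply_eq] using congrFun hid i

theorem Fin.card_subtype_fst_lt_snd (n : ℕ) :
    Fintype.card {e : Fin n × Fin n // e.1 < e.2} = n.choose 2 := by
  rw [Fintype.card_subtype, card_filter, Fintype.sum_prod_type_right]
  simp only [← card_filter, Finset.filter_gt_eq_Iio, Fin.card_Iio]
  rw [Fin.sum_univ_eq_sum_range (fun i => i), sum_range_id, Nat.choose_two_right]

/-- For `n` arbitrarily placed distinct destinations in the Euclidean
plane and `m = n(n-1)/2`, the number of permutations of the destinations realizable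
as the strict ordering by increasing distance from some viewpoint `r` is at most
`1 + m + m(m-1)/2` (the number of cells of an arrangement of `m` lines). -/
theorem card_realizable_orderings_le
    (n : ℕ) (p : Fin n → EuclideanSpace ℝ (Fin 2)) (hp : Function.Injective p)
    (m : ℕ) (hm : m = n * (n - 1) / 2) :
    {σ : Equiv.Perm (Fin n) | ∃ r : EuclideanSpace ℝ (Fin 2),
        ∀ i j : Fin n, i < j → dist r (p (σ i)) < dist r (p (σ j))}.ncard
      ≤ 1 + m + m * (m - 1) / 2 := by
  classical
  set S := {σ : Equiv.Perm (Fin n) | ∃ r : EuclideanSpace ℝ (Fin 2),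
    ∀ i j : Fin n, i < j → dist r (p (σ i)) < dist r (p (σ j))}
  let 𝒜 := S.toFinset.image Equiv.Perm.noninversions
  have hcard : S.ncard = #𝒜 := by
    rw [card_image_of_injective _ Equiv.Perm.noninversions_injective, Set.ncard_eq_toFinset_card']
  have hdim : 𝒜.vcDim ≤ 2 := by
    refine (vcDim_le_finrank_of_sign_patterns
      (fun e => (2 : ℝ) • (p e.1.2 - p e.1.1)) (fun e => ‖p e.1.1‖ ^ 2 - ‖p e.1.2‖ ^ 2) 𝒜
      fun u hu => ?_).trans_eq finrank_euclideanSpace_fin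
    obtain ⟨σ, hσ, rfl⟩ := mem_image.1 hu
    obtain ⟨r, hr⟩ := Set.mem_toFinset.1 hσ
    refine ⟨r, fun e => ⟨fun he => ?_, fun he => ?_⟩⟩
    · rw [← dist_lt_dist_iff_inner]
      simpa using hr _ _ (mem_filter.1 he).2
    · rw [← dist_lt_dist_iff_inner']
      have hle : σ.symm e.1.2 ≤ σ.symm e.1.1 := by
        simpa [Equiv.Perm.noninversions] using he
      simpa using hr _ _ (lt_of_le_of_ne hle (σ.symm.injective.ne e.2.ne'))
  calc S.ncard = #𝒜 := hcard
    _ ≤ #𝒜.shatterer := card_le_card_shatterer 𝒜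
    _ ≤ ∑ k ∈ Iic 𝒜.vcDim, (Fintype.card {e : Fin n × Fin n // e.1 < e.2}).choose k :=
      card_shatterer_le_sum_vcDim
    _ ≤ ∑ k ∈ Iic 2, m.choose k := by
      rw [Fin.card_subtype_fst_lt_snd, Nat.choose_two_right, ← hm]
      exact sum_le_sum_of_subset (Iic_subset_Iic.2 hdim)
    _ = 1 + m + m * (m - 1) / 2 := by
      rw [← Nat.range_succ_eq_Iic]
      simp [sum_range_succ, Nat.choose_two_right]
end
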